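/- Let n ≥ 1 and let B₂ := {e_1 + e_b : 1 ≤ b ≤ n} ⊂ ℕ^n (the degree-2 part of the first 2n+1 exponent vectors in graded lexicographic order). Then the set Y := { α+α'+e_i : α, α' ∈ B₂, 1 ≤ i ≤ n } has cardinality C(n+2,3), the set E₁ := { (α+e_i, β+e_j) : α ∈ B₂, β ∈ {e_1,…,e_n}, i ≠ j, β+e_j ∉ B₂, β+e_i ∈ B₂ } has cardinality n·C(n,2), and for every n ≥ 4 one has n·C(n,2) ≥ C(n+2,3). -/

import Mathlib

open scoped BigOperators

/-- The degree-2 part `B₂ = {e₁ + e_b : 1 ≤ b ≤ n}` of the first `2n+1` exponent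
vectors in graded lexicographic order (coordinates 0-indexed: `e₁` is `Pi.single 0 1`). -/
def B2 (n : ℕ) (hn : 0 < n) : Set (Fin n → ℕ) :=
  {γ | ∃ b : Fin n, γ = Pi.single (⟨0, hn⟩ : Fin n) 1 + Pi.single b 1}

/-- The set `Y` of moment variables. -/
def Yset (n : ℕ) (hn : 0 < n) : Set (Fin n → ℕ) :=
  {γ | ∃ α ∈ B2 n hn, ∃ α' ∈ B2 n hn, ∃ i : Fin n, γ = α + α' + Pi.single i 1}

/-- The index set `E₁` of the linear determinantal relations. -/
def E1set (n : ℕ) (hn : 0 < n) : Set ((Fin n → ℕ) × (Fin n → ℕ)) :=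
  {q | ∃ α ∈ B2 n hn, ∃ b i j : Fin n, i ≠ j ∧
        Pi.single b 1 + Pi.single j 1 ∉ B2 n hn ∧
        Pi.single b 1 + Pi.single i 1 ∈ B2 n hn ∧
        q = (α + Pi.single i 1, Pi.single b 1 + Pi.single j 1)}

/-- Exponent vector of a multiset. -/
def cnt {α : Type} {n : ℕ} (g : α → Fin n) (s : Multiset α) : Fin n → ℕ :=
  fun i => (s.map g).count i

theorem cnt_zero {α : Type} {n : ℕ} (g : α → Fin n) : cnt g 0 = 0 := by
  funext i; simp [cnt]

theorem cnt_cons {α : Type} {n : ℕ} (g : α → Fin n) (a : α) (s : Multiset α) :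
    cnt g (a ::ₘ s) = cnt g s + Pi.single (g a) 1 := by
  funext i
  simp [cnt, Multiset.count_cons, Pi.single_apply]

theorem cnt_pair {α : Type} {n : ℕ} (g : α → Fin n) (a b : α) :
    cnt g {a, b} = Pi.single (g a) 1 + Pi.single (g b) 1 := by
  have : ({a, b} : Multiset α) = a ::ₘ b ::ₘ 0 := rfl
  rw [this, cnt_cons, cnt_cons, cnt_zero]; abel

theorem cnt_triple {α : Type} {n : ℕ} (g : α → Fin n) (a b c : α) :
    cnt g {a, b, c} = Pi.single (g a) 1 + Pi.single (g b) 1 + Pi.single (g c) 1 := by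
  have : ({a, b, c} : Multiset α) = a ::ₘ b ::ₘ c ::ₘ 0 := rfl
  rw [this, cnt_cons, cnt_cons, cnt_cons, cnt_zero]; abel

theorem cnt_inj {α : Type} {n : ℕ} (g : α → Fin n) (hg : Function.Injective g) :
    Function.Injective (cnt g) := by
  intro s t h
  apply Multiset.map_injective hg
  ext i
  exact congrFun h i

theorem Y_card (n : ℕ) (hn : 0 < n) : (Yset n hn).ncard = Nat.choose (n+2) 3 := by
  have h : Yset n hn = Set.range (fun s : Sym (Fin n) 3 =>
      Pi.single (⟨0, hn⟩ : Fin n) 1 + Pi.single (⟨0, hn⟩ : Fin n) 1 + cnt id s.1) := by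
    ext γ
    constructor
    · rintro ⟨_, ⟨a, rfl⟩, _, ⟨b, rfl⟩, i, rfl⟩
      refine ⟨⟨{a, b, i}, by simp⟩, ?_⟩
      simp only [cnt_triple, id]
      abel
    · rintro ⟨⟨s, hs⟩, rfl⟩
      obtain ⟨a, b, c, rfl⟩ := Multiset.card_eq_three.1 hs
      refine ⟨_, ⟨a, rfl⟩, _, ⟨b, rfl⟩, c, ?_⟩
      simp only [cnt_triple, id]
      abel
  rw [h, ← Set.image_univ, Set.ncard_image_of_injective, Set.ncard_univ, Nat.card_eq_fintype_card,
    Sym.card_sym_eq_choose, Fintype.card_fin]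
  · rfl
  · intro s t hst
    exact Subtype.ext (cnt_inj id Function.injective_id (add_left_cancel hst))

theorem pair_mem (n : ℕ) (hn : 0 < n) (b j : Fin n) :
    (Pi.single b 1 + Pi.single j 1 : Fin n → ℕ) ∈ B2 n hn ↔ b = ⟨0, hn⟩ ∨ j = ⟨0, hn⟩ := by
  constructor
  · rintro ⟨c, hc⟩
    have := congrFun hc ⟨0, hn⟩
    by_contra! hh
    simp [hh.1.symm, hh.2.symm, Pi.single_apply] at this
    omega
  · rintro (rfl | rfl)
    · exact ⟨_, rfl⟩
    · exact ⟨b, add_comm _ _⟩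

theorem E_card (n : ℕ) (hn : 0 < n) : (E1set n hn).ncard = n * Nat.choose n 2 := by
  obtain ⟨m, rfl⟩ : ∃ m, n = m + 1 := ⟨n - 1, by omega⟩
  have h : E1set (m+1) hn = Set.range (fun p : Fin (m+1) × Sym (Fin m) 2 =>
      ((Pi.single 0 1 + Pi.single 0 1 + Pi.single p.1 1, cnt Fin.succ p.2.1) :
        (Fin (m+1) → ℕ) × (Fin (m+1) → ℕ))) := by
    ext q
    constructor
    · rintro ⟨_, ⟨a, rfl⟩, b, i, j, hij, h1, h2, rfl⟩
      rw [pair_mem] at h1 h2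
      push Not at h1
      have hi : i = 0 := h2.resolve_left h1.1
      subst hi
      obtain ⟨b, rfl⟩ := Fin.exists_succ_eq.2 h1.1
      obtain ⟨j, rfl⟩ := Fin.exists_succ_eq.2 h1.2
      refine ⟨(a, ⟨{b, j}, by simp⟩), ?_⟩
      simp only [cnt_pair]
      refine Prod.ext ?_ rfl
      exact add_right_comm _ _ _
    · rintro ⟨⟨a, ⟨s, hs⟩⟩, rfl⟩
      obtain ⟨b, j, rfl⟩ := Multiset.card_eq_two.1 hs
      refine ⟨_, ⟨a, rfl⟩, b.succ, 0, j.succ, (Fin.succ_ne_zero j).symm, ?_, ?_, ?_⟩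
      · rw [pair_mem]
        rintro (h | h)
        · exact Fin.succ_ne_zero _ h
        · exact Fin.succ_ne_zero _ h
      · rw [pair_mem]; exact Or.inr rfl
      · simp only [cnt_pair]
        refine Prod.ext ?_ rfl
        exact add_right_comm _ _ _
  rw [h, ← Set.image_univ, Set.ncard_image_of_injective, Set.ncard_univ, Nat.card_eq_fintype_card,
    Fintype.card_prod, Sym.card_sym_eq_choose, Fintype.card_fin, Fintype.card_fin]
  · rfl
  · rintro ⟨a, s⟩ ⟨b, t⟩ hst
    have h1 := add_left_cancel (congrArg Prod.fst hst)
    have h2 := Subtype.ext (cnt_inj Fin.succ (Fin.succ_injective m) (congrArg Prod.snd hst))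
    have h3 : a = b := by
      have := congrFun h1 a
      by_contra hab
      simp [hab] at this
    exact Prod.ext h3 h2

theorem ineq (n : ℕ) (h4 : 4 ≤ n) : Nat.choose (n+2) 3 ≤ n * Nat.choose n 2 := by
  obtain ⟨k, rfl⟩ := Nat.exists_eq_add_of_le h4
  have h1 := Nat.descFactorial_eq_factorial_mul_choose (4+k+2) 3
  have h2 := Nat.descFactorial_eq_factorial_mul_choose (4+k) 2
  have e1 : (4+k+2).descFactorial 3 = (k+4)*((k+5)*(k+6)) := by
    simp [Nat.descFactorial]
    ring
  have e2 : (4+k).descFactorial 2 = (k+3)*(k+4) := by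
    simp [Nat.descFactorial]
    ring
  rw [e1] at h1
  rw [e2] at h2
  simp [Nat.factorial] at h1 h2
  have : 6 * ((4+k+2).choose 3) ≤ 6 * ((4+k) * (4+k).choose 2) := by
    rw [← h1, show 6 * ((4+k) * (4+k).choose 2) = 3 * (4+k) * (2 * (4+k).choose 2) by ring, ← h2]
    ring_nf
    nlinarith [sq_nonneg k, Nat.zero_le (k^3)]
  omega

/-- Counts for the rank `r = 2n+1` case (`c = 1`): `|Y| = C(n+2,3)`,
`|E₁| = n·C(n,2)`, and for `n ≥ 4` the number of equations dominates. -/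
theorem statement12 (n : ℕ) (hn : 0 < n) :
    (Yset n hn).ncard = Nat.choose (n+2) 3 ∧
    (E1set n hn).ncard = n * Nat.choose n 2 ∧
    (4 ≤ n → Nat.choose (n+2) 3 ≤ n * Nat.choose n 2) := by
  exact ⟨Y_card n hn, E_card n hn, ineq n⟩
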